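/- arXiv:1307.1810 — 2 statements merged into one kernel-verified Lean document; each statement's English description precedes it below -/
import Mathlib

section
/- There exists a finite simple graph in which every vertex has degree at most 4 that is not word-representable. -/
def Alternates {V : Type*} [DecidableEq V] (w : List V) (x y : V) : Prop :=
  (w.filter (fun z => z = x ∨ z = y)).Chain' (· ≠ ·)

def Represents {V : Type*} [DecidableEq V] (w : List V) (G : SimpleGraph V) : Prop :=
  (∀ v : V, v ∈ w) ∧ ∀ x y : V, x ≠ y → (Alternates w x y ↔ G.Adj x y)

def WordRepresentable {V : Type*} [DecidableEq V] (G : SimpleGraph V) : Prop :=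
  ∃ w : List V, Represents w G

/-- Edges of the 4-regular example on eight vertices. -/
def exE (x y : Fin 8) : Bool :=
  [(0, 3), (0, 4), (0, 5), (0, 6), (1, 2), (1, 3), (1, 4), (1, 7), (2, 5), (2, 6), (2, 7), (3, 5), (3, 7), (4, 6), (4, 7), (5, 6)].contains (x.val, y.val)

def exG : SimpleGraph (Fin 8) where
  Adj x y := exE x y = true ∨ exE y x = true
  symm := ⟨fun _ _ h => h.symm⟩
  loopless := ⟨by decide⟩

instance : DecidableRel exG.Adj := fun x y =>
  inferInstanceAs (Decidable (exE x y = true ∨ exE y x = true))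

/-- `Dir w x y`: the letters `x`, `y` alternate in `w`, starting with `x`. -/
def Dir {V : Type*} [DecidableEq V] (w : List V) (x y : V) : Prop :=
  ∀ p, p <+: w → p.count y ≤ p.count x ∧ p.count x ≤ p.count y + 1

/-- Every prefix has at least as many `x` as `y`. -/
def Dom {V : Type*} [DecidableEq V] (w : List V) (x y : V) : Prop :=
  ∀ p, p <+: w → p.count y ≤ p.count x

theorem dir_cons {V : Type*} [DecidableEq V] (w : List V) (z x y : V) :
    Dir (z :: w) x y ↔ ∀ p, p <+: w →
      (z :: p).count y ≤ (z :: p).count x ∧ (z :: p).count x ≤ (z :: p).count y + 1 := by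
  constructor
  · intro h p hp
    exact h _ ((List.cons_prefix_cons).2 ⟨rfl, hp⟩)
  · intro h p hp
    cases p with
    | nil => simp
    | cons a p =>
      obtain ⟨rfl, hp'⟩ := List.cons_prefix_cons.1 hp
      exact h p hp'

theorem dir_iff {V : Type*} [DecidableEq V] (w : List V) : ∀ (x y : V), x ≠ y →
    (Dir w x y ↔ (y :: w.filter (fun z => z = x ∨ z = y)).IsChain (· ≠ ·)) := by
  induction w with
  | nil => intro x y _; simp [Dir]
  | cons z w ih =>
    intro x y hxy
    rw [dir_cons]
    by_cases hzx : z = x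
    · subst hzx
      have h1 := ih y z hxy.symm
      have h2 : (w.filter (fun a => a = z ∨ a = y)) = w.filter (fun a => a = y ∨ a = z) := by
        congr 1; funext a; simp [or_comm]
      rw [List.filter_cons_of_pos (by simp), h2, List.isChain_cons_cons, ← h1]
      simp only [Dir, List.count_cons_self, List.count_cons_of_ne hxy]
      constructor
      · intro h
        refine ⟨hxy.symm, fun p hp => ?_⟩
        have := h p hp
        omega
      · rintro ⟨-, h⟩ p hp
        have := h p hp
        omega
    · by_cases hzy : z = y
      · subst hzy
        rw [List.filter_cons_of_pos (by simp), List.isChain_cons_cons]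
        constructor
        · intro h
          have := (h [] List.nil_prefix).1
          simp [hzx] at this
        · rintro ⟨h, -⟩
          exact absurd rfl h
      · rw [List.filter_cons_of_neg (by simp [hzx, hzy]), ← ih x y hxy]
        simp only [Dir, List.count_cons_of_ne hzx, List.count_cons_of_ne hzy]

theorem Dir.alternates {V : Type*} [DecidableEq V] {w : List V} {x y : V} (hxy : x ≠ y)
    (h : Dir w x y) : Alternates w x y := by
  have := (dir_iff w x y hxy).1 h
  exact this.tail

theorem Alternates.dir_or {V : Type*} [DecidableEq V] {w : List V} {x y : V} (hxy : x ≠ y)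
    (h : Alternates w x y) : Dir w x y ∨ Dir w y x := by
  have h2 : (w.filter (fun a => a = y ∨ a = x)) = w.filter (fun a => a = x ∨ a = y) := by
    congr 1; funext a; simp [or_comm]
  rw [dir_iff w x y hxy, dir_iff w y x hxy.symm, h2]
  have hc : (w.filter (fun z => z = x ∨ z = y)).IsChain (· ≠ ·) := h
  clear h
  have hm : ∀ a ∈ w.filter (fun z => z = x ∨ z = y), a = x ∨ a = y := by
    intro a ha
    simpa using (List.mem_filter.1 ha).2
  revert hc hm
  generalize w.filter (fun z => z = x ∨ z = y) = l
  intro h hm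
  cases l with
  | nil => simp
  | cons a l =>
    rcases hm a (by simp) with rfl | rfl
    · exact Or.inl (List.isChain_cons_cons.2 ⟨hxy.symm, h⟩)
    · exact Or.inr (List.isChain_cons_cons.2 ⟨hxy, h⟩)

theorem Dom.antisymm_false {V : Type*} [DecidableEq V] {w : List V} {x y : V} (hxy : x ≠ y)
    (hx : x ∈ w) (h1 : Dom w x y) (h2 : Dom w y x) : False := by
  obtain ⟨s, t, rfl⟩ := List.append_of_mem hx
  have p1 : s <+: s ++ x :: t := List.prefix_append _ _
  have p2 : s ++ [x] <+: s ++ x :: t := ⟨t, by simp⟩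
  have a1 := h1 _ p1
  have a2 := h2 _ p2
  simp [hxy] at a2
  omega

/-- The combinatorial core: the graph has no semi-transitive orientation. -/
theorem core (L D : Fin 8 → Fin 8 → Prop) (r : ∀ x, L x x)
    (t : ∀ {x y z}, L x y → L y z → L x z) (s : ∀ {x y}, D x y → L x y)
    (tot : ∀ x y, exG.Adj x y → D x y ∨ D y x)
    (cyc : ∀ {x y}, L x y → D y x → x ≠ y → False)
    (sc : ∀ {a x y b}, x ≠ y → ¬ exG.Adj x y → L a x → L x y → L y b → D a b → False)
    (h56 : D 5 6) : False := by
  obtain h26 | h62 := tot 2 6 (by decide)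
  · obtain h06 | h60 := tot 0 6 (by decide)
    · obtain h46 | h64 := tot 4 6 (by decide)
      · obtain h25 | h52 := tot 2 5 (by decide)
        · obtain h50 | h05 := tot 5 0 (by decide)
          · exact sc (by decide) (by decide) (r _) (t (s h25) (s h50)) (s h06) h26
          obtain h40 | h04 := tot 4 0 (by decide)
          · exact sc (by decide) (by decide) (r _) (t (s h40) (s h05)) (s h56) h46
          obtain h47 | h74 := tot 4 7 (by decide)
          · obtain h72 | h27 := tot 7 2 (by decide)
            · exact sc (by decide) (by decide) (r _) (t (s h04) (s h47)) (t (s h72) (s h25)) h05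
            obtain h37 | h73 := tot 3 7 (by decide)
            · obtain h30 | h03 := tot 3 0 (by decide)
              · exact sc (by decide) (by decide) (r _) (t (s h30) (s h04)) (s h47) h37
              obtain h35 | h53 := tot 3 5 (by decide)
              · exact sc (by decide) (by decide) (s h03) (t (s h35) (s h56)) (r _) h06
              · exact sc (by decide) (by decide) (r _) (t (s h25) (s h53)) (s h37) h27
            · obtain h03 | h30 := tot 0 3 (by decide)
              · exact sc (by decide) (by decide) (r _) (t (s h04) (s h47)) (s h73) h03
              · exact sc (by decide) (by decide) (r _) (t (s h27) (s h73)) (t (s h30) (s h06)) h26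
          · obtain h27 | h72 := tot 2 7 (by decide)
            · exact sc (by decide) (by decide) (r _) (t (s h27) (s h74)) (s h46) h26
            obtain h37 | h73 := tot 3 7 (by decide)
            · obtain h35 | h53 := tot 3 5 (by decide)
              · exact sc (by decide) (by decide) (r _) (t (s h37) (s h72)) (s h25) h35
              · exact cyc (t (s h25) (t (s h53) (s h37))) h72 (by decide)
            · obtain h30 | h03 := tot 3 0 (by decide)
              · exact sc (by decide) (by decide) (r _) (t (s h73) (s h30)) (s h04) h74
              obtain h35 | h53 := tot 3 5 (by decide)
              · exact sc (by decide) (by decide) (s h03) (t (s h35) (s h56)) (r _) h06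
              · exact sc (by decide) (by decide) (r _) (t (s h72) (s h25)) (s h53) h73
        · obtain h05 | h50 := tot 0 5 (by decide)
          · exact sc (by decide) (by decide) (r _) (t (s h05) (s h52)) (s h26) h06
          obtain h04 | h40 := tot 0 4 (by decide)
          · exact sc (by decide) (by decide) (r _) (t (s h50) (s h04)) (s h46) h56
          obtain h47 | h74 := tot 4 7 (by decide)
          · obtain h72 | h27 := tot 7 2 (by decide)
            · exact sc (by decide) (by decide) (r _) (t (s h47) (s h72)) (s h26) h46
            obtain h37 | h73 := tot 3 7 (by decide)
            · obtain h03 | h30 := tot 0 3 (by decide)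
              · exact sc (by decide) (by decide) (r _) (t (s h40) (s h03)) (s h37) h47
              obtain h35 | h53 := tot 3 5 (by decide)
              · exact sc (by decide) (by decide) (r _) (t (s h35) (s h52)) (s h27) h37
              · exact sc (by decide) (by decide) (s h53) (t (s h30) (s h06)) (r _) h56
            · obtain h35 | h53 := tot 3 5 (by decide)
              · exact cyc (t (s h27) (t (s h73) (s h35))) h52 (by decide)
              · exact sc (by decide) (by decide) (r _) (t (s h52) (s h27)) (s h73) h53
          · obtain h27 | h72 := tot 2 7 (by decide)
            · exact sc (by decide) (by decide) (r _) (t (s h52) (s h27)) (t (s h74) (s h40)) h50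
            obtain h37 | h73 := tot 3 7 (by decide)
            · obtain h03 | h30 := tot 0 3 (by decide)
              · exact sc (by decide) (by decide) (r _) (t (s h03) (s h37)) (t (s h72) (s h26)) h06
              · exact sc (by decide) (by decide) (r _) (t (s h37) (s h74)) (s h40) h30
            · obtain h03 | h30 := tot 0 3 (by decide)
              · exact sc (by decide) (by decide) (r _) (t (s h74) (s h40)) (s h03) h73
              obtain h35 | h53 := tot 3 5 (by decide)
              · exact sc (by decide) (by decide) (r _) (t (s h73) (s h35)) (s h52) h72
              · exact sc (by decide) (by decide) (s h53) (t (s h30) (s h06)) (r _) h56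
      · obtain h40 | h04 := tot 4 0 (by decide)
        · exact cyc (t (s h06) (s h64)) h40 (by decide)
        obtain h05 | h50 := tot 0 5 (by decide)
        · exact sc (by decide) (by decide) (s h05) (t (s h56) (s h64)) (r _) h04
        obtain h25 | h52 := tot 2 5 (by decide)
        · exact sc (by decide) (by decide) (r _) (t (s h25) (s h50)) (s h06) h26
        obtain h47 | h74 := tot 4 7 (by decide)
        · obtain h27 | h72 := tot 2 7 (by decide)
          · exact sc (by decide) (by decide) (r _) (t (s h26) (s h64)) (s h47) h27
          · exact sc (by decide) (by decide) (r _) (t (s h50) (s h04)) (t (s h47) (s h72)) h52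
        · obtain h72 | h27 := tot 7 2 (by decide)
          · exact sc (by decide) (by decide) (r _) (t (s h72) (s h26)) (s h64) h74
          obtain h37 | h73 := tot 3 7 (by decide)
          · obtain h03 | h30 := tot 0 3 (by decide)
            · exact sc (by decide) (by decide) (r _) (t (s h03) (s h37)) (s h74) h04
            obtain h35 | h53 := tot 3 5 (by decide)
            · exact sc (by decide) (by decide) (r _) (t (s h35) (s h52)) (s h27) h37
            · exact sc (by decide) (by decide) (s h53) (t (s h30) (s h06)) (r _) h56
          · obtain h35 | h53 := tot 3 5 (by decide)
            · exact cyc (t (s h27) (t (s h73) (s h35))) h52 (by decide)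
            · exact sc (by decide) (by decide) (r _) (t (s h52) (s h27)) (s h73) h53
    · obtain h05 | h50 := tot 0 5 (by decide)
      · exact cyc (t (s h05) (s h56)) h60 (by decide)
      obtain h52 | h25 := tot 5 2 (by decide)
      · exact sc (by decide) (by decide) (s h52) (t (s h26) (s h60)) (r _) h50
      obtain h35 | h53 := tot 3 5 (by decide)
      · obtain h03 | h30 := tot 0 3 (by decide)
        · exact cyc (t (s h03) (s h35)) h50 (by decide)
        · exact sc (by decide) (by decide) (r _) (t (s h35) (s h56)) (s h60) h30
      · obtain h03 | h30 := tot 0 3 (by decide)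
        · exact sc (by decide) (by decide) (s h56) (t (s h60) (s h03)) (r _) h53
        obtain h37 | h73 := tot 3 7 (by decide)
        · obtain h27 | h72 := tot 2 7 (by decide)
          · exact sc (by decide) (by decide) (r _) (t (s h25) (s h53)) (s h37) h27
          · exact sc (by decide) (by decide) (r _) (t (s h37) (s h72)) (t (s h26) (s h60)) h30
        · obtain h72 | h27 := tot 7 2 (by decide)
          · exact sc (by decide) (by decide) (r _) (t (s h72) (s h25)) (s h53) h73
          obtain h47 | h74 := tot 4 7 (by decide)
          · obtain h04 | h40 := tot 0 4 (by decide)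
            · exact cyc (t (s h04) (t (s h47) (s h73))) h30 (by decide)
            · exact sc (by decide) (by decide) (r _) (t (s h47) (s h73)) (s h30) h40
          · obtain h04 | h40 := tot 0 4 (by decide)
            · exact sc (by decide) (by decide) (r _) (t (s h73) (s h30)) (s h04) h74
            obtain h46 | h64 := tot 4 6 (by decide)
            · exact sc (by decide) (by decide) (r _) (t (s h27) (s h74)) (s h46) h26
            · exact sc (by decide) (by decide) (r _) (t (s h56) (s h64)) (s h40) h50
  · obtain h25 | h52 := tot 2 5 (by decide)
    · exact cyc (t (s h25) (s h56)) h62 (by decide)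
    obtain h06 | h60 := tot 0 6 (by decide)
    · obtain h50 | h05 := tot 5 0 (by decide)
      · exact sc (by decide) (by decide) (s h50) (t (s h06) (s h62)) (r _) h52
      obtain h46 | h64 := tot 4 6 (by decide)
      · obtain h40 | h04 := tot 4 0 (by decide)
        · exact sc (by decide) (by decide) (r _) (t (s h40) (s h05)) (s h56) h46
        obtain h47 | h74 := tot 4 7 (by decide)
        · obtain h27 | h72 := tot 2 7 (by decide)
          · exact sc (by decide) (by decide) (r _) (t (s h46) (s h62)) (s h27) h47
          obtain h37 | h73 := tot 3 7 (by decide)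
          · obtain h30 | h03 := tot 3 0 (by decide)
            · exact sc (by decide) (by decide) (r _) (t (s h30) (s h04)) (s h47) h37
            obtain h35 | h53 := tot 3 5 (by decide)
            · exact sc (by decide) (by decide) (s h03) (t (s h35) (s h56)) (r _) h06
            · exact sc (by decide) (by decide) (r _) (t (s h53) (s h37)) (s h72) h52
          · obtain h03 | h30 := tot 0 3 (by decide)
            · exact sc (by decide) (by decide) (r _) (t (s h04) (s h47)) (s h73) h03
            · exact sc (by decide) (by decide) (r _) (t (s h73) (s h30)) (t (s h06) (s h62)) h72
        · obtain h27 | h72 := tot 2 7 (by decide)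
          · exact sc (by decide) (by decide) (r _) (t (s h05) (s h52)) (t (s h27) (s h74)) h04
          · exact sc (by decide) (by decide) (r _) (t (s h74) (s h46)) (s h62) h72
      · obtain h04 | h40 := tot 0 4 (by decide)
        · exact sc (by decide) (by decide) (s h05) (t (s h56) (s h64)) (r _) h04
        · exact cyc (t (s h06) (s h64)) h40 (by decide)
    · obtain h05 | h50 := tot 0 5 (by decide)
      · exact cyc (t (s h05) (s h56)) h60 (by decide)
      obtain h35 | h53 := tot 3 5 (by decide)
      · obtain h03 | h30 := tot 0 3 (by decide)
        · exact cyc (t (s h03) (s h35)) h50 (by decide)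
        · exact sc (by decide) (by decide) (r _) (t (s h35) (s h56)) (s h60) h30
      · obtain h03 | h30 := tot 0 3 (by decide)
        · exact sc (by decide) (by decide) (s h56) (t (s h60) (s h03)) (r _) h53
        obtain h46 | h64 := tot 4 6 (by decide)
        · obtain h04 | h40 := tot 0 4 (by decide)
          · exact cyc (t (s h04) (s h46)) h60 (by decide)
          obtain h47 | h74 := tot 4 7 (by decide)
          · obtain h73 | h37 := tot 7 3 (by decide)
            · exact sc (by decide) (by decide) (r _) (t (s h47) (s h73)) (s h30) h40
            obtain h27 | h72 := tot 2 7 (by decide)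
            · exact sc (by decide) (by decide) (r _) (t (s h46) (s h62)) (s h27) h47
            · exact sc (by decide) (by decide) (r _) (t (s h53) (s h37)) (s h72) h52
          · obtain h27 | h72 := tot 2 7 (by decide)
            · exact sc (by decide) (by decide) (r _) (t (s h52) (s h27)) (t (s h74) (s h40)) h50
            · exact sc (by decide) (by decide) (r _) (t (s h74) (s h46)) (s h62) h72
        · obtain h40 | h04 := tot 4 0 (by decide)
          · exact sc (by decide) (by decide) (r _) (t (s h56) (s h64)) (s h40) h50
          obtain h47 | h74 := tot 4 7 (by decide)
          · obtain h37 | h73 := tot 3 7 (by decide)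
            · exact sc (by decide) (by decide) (r _) (t (s h30) (s h04)) (s h47) h37
            · exact cyc (t (s h04) (t (s h47) (s h73))) h30 (by decide)
          · obtain h73 | h37 := tot 7 3 (by decide)
            · exact sc (by decide) (by decide) (r _) (t (s h73) (s h30)) (s h04) h74
            obtain h27 | h72 := tot 2 7 (by decide)
            · exact sc (by decide) (by decide) (r _) (t (s h62) (s h27)) (s h74) h64
            · exact sc (by decide) (by decide) (r _) (t (s h53) (s h37)) (s h72) h52

theorem exG_not : ¬ WordRepresentable exG := by
  rintro ⟨w, hmem, hw⟩
  have dl : ∀ {x y}, Dir w x y → Dom w x y := fun h p hp => (h p hp).1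
  have tot : ∀ x y, exG.Adj x y → Dir w x y ∨ Dir w y x := fun x y h =>
    Alternates.dir_or h.ne ((hw x y h.ne).2 h)
  have tr : ∀ {x y z}, Dom w x y → Dom w y z → Dom w x z := fun h1 h2 p hp =>
    (h2 p hp).trans (h1 p hp)
  have cyc : ∀ {x y}, Dom w x y → Dir w y x → x ≠ y → False := fun h1 h2 hne =>
    Dom.antisymm_false hne (hmem _) h1 (dl h2)
  have sc : ∀ {a x y b}, x ≠ y → ¬ exG.Adj x y → Dom w a x → Dom w x y → Dom w y b →
      Dir w a b → False := by
    intro a x y b hxy hn h1 h2 h3 h4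
    refine hn ((hw x y hxy).1 (Dir.alternates hxy fun p hp => ⟨h2 p hp, ?_⟩))
    have := h1 p hp
    have := h3 p hp
    have := (h4 p hp).2
    omega
  have nadj : ∀ {x y}, ¬ exG.Adj x y → ¬ exG.Adj y x := fun h h' => h h'.symm
  rcases tot 5 6 (by decide) with h | h
  · exact core (Dom w) (Dir w) (fun x p _ => le_rfl) tr dl tot cyc sc h
  · exact core (fun x y => Dom w y x) (fun x y => Dir w y x) (fun x p _ => le_rfl)
      (fun h1 h2 => tr h2 h1) dl (fun x y h => (tot x y h).symm)
      (fun h1 h2 hne => cyc h1 h2 hne.symm)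
      (fun {a x y b} hne hn h1 h2 h3 h4 => sc hne.symm (nadj hn) h3 h2 h1 h4) h

theorem exists_maxDegree_four_not_wordRepresentable :
    ∃ (n : ℕ) (G : SimpleGraph (Fin n)),
      (∀ v : Fin n, {u : Fin n | G.Adj v u}.ncard ≤ 4) ∧ ¬ WordRepresentable G := by
  refine ⟨8, exG, ?_, exG_not⟩
  intro v
  rw [Set.ncard_eq_toFinset_card']
  revert v
  decide
end

section
/- Every finite simple graph in which every vertex has degree at most 3 is word-representable. -/
/-- `Alt2 u v l`: the list `l` is `u v u v ... u v`. -/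
inductive Alt2 {V : Type*} (u v : V) : List V → Prop
  | nil : Alt2 u v []
  | cons (l : List V) : Alt2 u v l → Alt2 u v (u :: v :: l)

lemma Alt2.append {V : Type*} {u v : V} {l m : List V} (hl : Alt2 u v l) (hm : Alt2 u v m) :
    Alt2 u v (l ++ m) := by
  induction hl with
  | nil => simpa using hm
  | cons l _ ih => exact Alt2.cons _ ih

lemma Alt2.chain {V : Type*} {u v : V} (huv : u ≠ v) {l : List V} (hl : Alt2 u v l) :
    l.IsChain (· ≠ ·) ∧ ∀ y ∈ l.head?, y = u := by
  induction hl with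
  | nil => simp
  | cons l _ ih =>
    refine ⟨?_, by simp⟩
    rw [List.isChain_cons_cons, List.isChain_cons]
    refine ⟨huv, ?_, ih.1⟩
    intro y hy
    rw [ih.2 y hy]
    exact huv.symm

/-- Every edge, oriented by `g`, projects to `u v u v ... u v`. -/
def GoodWord {V : Type*} [DecidableEq V] (G : SimpleGraph V) (g : V → ℕ) (w : List V) : Prop :=
  ∀ u v, G.Adj u v → g u < g v → Alt2 u v (w.filter (fun z => z = u ∨ z = v))

lemma GoodWord.append {V : Type*} [DecidableEq V] {G : SimpleGraph V} {g : V → ℕ} {l m : List V}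
    (hl : GoodWord G g l) (hm : GoodWord G g m) : GoodWord G g (l ++ m) := by
  intro u v h h'
  rw [List.filter_append]
  exact (hl u v h h').append (hm u v h h')

lemma Alternates.symm' {V : Type*} [DecidableEq V] {w : List V} {x y : V}
    (h : Alternates w x y) : Alternates w y x := by
  unfold Alternates at *
  simpa only [or_comm] using h

lemma Alternates.left {V : Type*} [DecidableEq V] {l m : List V} {x y : V}
    (h : Alternates (l ++ m) x y) : Alternates l x y := by
  unfold Alternates at *
  rw [List.filter_append] at h
  exact List.IsChain.left_of_append h

lemma Alternates.right {V : Type*} [DecidableEq V] {l m : List V} {x y : V}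
    (h : Alternates (l ++ m) x y) : Alternates m x y := by
  unfold Alternates at *
  rw [List.filter_append] at h
  exact List.IsChain.right_of_append h

lemma exists_sorted {V : Type*} [Fintype V] [DecidableEq V] (κ : V → ℕ) :
    ∃ P : List V, (∀ v, v ∈ P) ∧
      ∀ u v, κ u < κ v → P.filter (fun z => z = u ∨ z = v) = [u, v] := by
  let P := (Finset.univ : Finset V).toList.mergeSort (fun a b => decide (κ a ≤ κ b))
  have hperm : P.Perm (Finset.univ : Finset V).toList := List.mergeSort_perm _ _
  have hnd : P.Nodup := hperm.nodup_iff.2 (Finset.nodup_toList _)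
  have hmem : ∀ v, v ∈ P := fun v => hperm.mem_iff.2 (by simp)
  have hs : P.Pairwise (fun a b => κ a ≤ κ b) := by
    have := List.pairwise_mergeSort (le := fun a b : V => decide (κ a ≤ κ b))
      (by intro a b c; simp only [decide_eq_true_eq]; omega)
      (by intro a b; simp only [Bool.or_eq_true, decide_eq_true_eq]; omega)
      (Finset.univ : Finset V).toList
    simpa only [decide_eq_true_eq] using this
  refine ⟨P, hmem, fun u v huv => ?_⟩
  have hne : u ≠ v := by rintro rfl; omega
  have h1 : (P.filter (fun z => z = u ∨ z = v)).Perm [u, v] := by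
    rw [List.perm_ext_iff_of_nodup (hnd.filter _) (by simp [hne])]
    intro a
    simp [hmem]
  rcases List.perm_pair.1 h1 with h | h
  · exact h
  · have := hs.filter (fun z => decide (z = u ∨ z = v))
    rw [h] at this
    simp at this
    omega

lemma goodWord_of_sorted {V : Type*} [DecidableEq V] {G : SimpleGraph V} {g κ : V → ℕ}
    (hκ : ∀ u v, G.Adj u v → g u < g v → κ u < κ v) {P : List V}
    (hP : ∀ u v, κ u < κ v → P.filter (fun z => z = u ∨ z = v) = [u, v]) :
    GoodWord G g P := by
  intro u v h h'
  rw [hP u v (hκ u v h h')]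
  exact Alt2.cons _ Alt2.nil

lemma exists_word_of_keys {V : Type*} [Fintype V] [DecidableEq V] {G : SimpleGraph V}
    {g : V → ℕ} {x y : V} (κ₁ κ₂ : V → ℕ)
    (h₁ : ∀ u v, G.Adj u v → g u < g v → κ₁ u < κ₁ v)
    (h₂ : ∀ u v, G.Adj u v → g u < g v → κ₂ u < κ₂ v)
    (hx : κ₁ x < κ₁ y) (hy : κ₂ y < κ₂ x) :
    ∃ w, GoodWord G g w ∧ ¬ Alternates w x y := by
  obtain ⟨P, -, hP⟩ := exists_sorted κ₁
  obtain ⟨Q, -, hQ⟩ := exists_sorted κ₂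
  refine ⟨P ++ Q, (goodWord_of_sorted h₁ hP).append (goodWord_of_sorted h₂ hQ), ?_⟩
  unfold Alternates
  have h3 : Q.filter (fun z => z = x ∨ z = y) = [y, x] := by
    rw [← hQ y x hy]
    simp only [or_comm]
  rw [List.filter_append, hP x y hx, h3]
  intro h
  have h' : List.IsChain (· ≠ ·) ([x, y] ++ [y, x]) := h
  simp at h'

lemma exists_word_aux {V : Type*} [Fintype V] [DecidableEq V] {G : SimpleGraph V}
    {g : V → ℕ} (hg3 : ∀ x y, G.Reachable x y → x ≠ y → ¬ G.Adj x y →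
      ∀ z, G.Reachable x z → g z < 3) {x y : V} (hxy : x ≠ y) (hadj : ¬ G.Adj x y)
    (hle : g x ≤ g y) : ∃ w, GoodWord G g w ∧ ¬ Alternates w x y := by
  classical
  by_cases hr : G.Reachable x y
  swap
  · obtain ⟨M, hM⟩ : ∃ M, ∀ v, g v < M := by
      refine ⟨∑ v, g v + 1, fun v => ?_⟩
      have := Finset.single_le_sum (f := g) (fun _ _ => Nat.zero_le _) (Finset.mem_univ v)
      omega
    have hR : ∀ u v, G.Adj u v → (G.Reachable x u ↔ G.Reachable x v) := fun u v h =>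
      ⟨fun h' => h'.trans h.reachable, fun h' => h'.trans h.symm.reachable⟩
    refine exists_word_of_keys (fun z => g z + if G.Reachable x z then 0 else M)
      (fun z => g z + if G.Reachable x z then M else 0) ?_ ?_ ?_ ?_
    · intro u v h h'
      simp only [hR u v h]
      omega
    · intro u v h h'
      simp only [hR u v h]
      omega
    · have := hM x
      simp [hr]
      omega
    · have := hM y
      simp [hr]
      omega
  by_cases hlt : g y ≤ g x + 1
  · have key : ∀ a b : ℕ, a < b → 10 * a + 10 ≤ 10 * b := by intro a b; omega
    refine exists_word_of_keys (fun z => 10 * g z + if z = y then 1 else 0)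
      (fun z => if z = x then 10 * g x + 6 else if z = y then 10 * g x + 5 else
        if g z ≤ g x then 10 * g z else 10 * g z + 1) ?_ ?_ ?_ ?_
    · intro u v h h'
      have := key _ _ h'
      split_ifs <;> omega
    · intro u v h h'
      have := key _ _ h'
      have hvu := h.symm
      split_ifs <;> subst_vars <;> first | contradiction | omega
    · simp [hxy]
      omega
    · simp [hxy.symm]
  · have hgy := hg3 x y hr hxy hadj y hr
    have hgx : g x = 0 := by omega
    obtain ⟨P, -, hP⟩ := exists_sorted g
    refine ⟨P.filter (· ≠ y) ++ ([x, y] ++ P.filter (· ≠ x)), ?_, ?_⟩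
    · intro u v h h'
      have e1 : ∀ t : V, (P.filter (· ≠ t)).filter (fun z => z = u ∨ z = v)
          = [u, v].filter (· ≠ t) := by
        intro t
        rw [← hP u v h', List.filter_filter, List.filter_filter]
        simp only [Bool.and_comm]
      rw [List.filter_append, List.filter_append, e1, e1]
      have hvx : v ≠ x := by rintro rfl; omega
      have huy : u ≠ y := by
        rintro rfl
        have := hg3 x u hr hxy hadj v (hr.trans h.reachable)
        omega
      have huv : u ≠ v := h.ne
      have hn : ¬ (u = x ∧ v = y) := by rintro ⟨rfl, rfl⟩; exact hadj h
      by_cases hux : u = x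
      · subst hux
        have hvy : v ≠ y := fun e => hn ⟨rfl, e⟩
        simp [hvy, huy, huv.symm, huy.symm, hvy.symm]
        exact Alt2.cons _ (Alt2.cons _ Alt2.nil)
      · by_cases hvy : v = y
        · subst hvy
          simp [huv, hux, hvx, Ne.symm hvx, Ne.symm hux]
          exact Alt2.cons _ (Alt2.cons _ Alt2.nil)
        · simp [huy, hux, hvx, hvy, Ne.symm hvx, Ne.symm hux, Ne.symm huy, Ne.symm hvy]
          exact Alt2.cons _ (Alt2.cons _ Alt2.nil)
    · have e1 : ∀ t : V, (P.filter (· ≠ t)).filter (fun z => z = x ∨ z = y)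
          = [x, y].filter (· ≠ t) := by
        intro t
        rw [← hP x y (by omega), List.filter_filter, List.filter_filter]
        simp only [Bool.and_comm]
      unfold Alternates
      rw [List.filter_append, List.filter_append, e1, e1]
      intro h
      replace h : List.IsChain (· ≠ ·) _ := h
      simp [hxy, hxy.symm] at h

lemma wordRepresentable_of_coloring {V : Type*} [Fintype V] [DecidableEq V] {G : SimpleGraph V}
    {g : V → ℕ} (hg : ∀ u v, G.Adj u v → g u ≠ g v)
    (hg3 : ∀ x y, G.Reachable x y → x ≠ y → ¬ G.Adj x y →
      ∀ z, G.Reachable x z → g z < 3) : WordRepresentable G := by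
  classical
  have h1 : ∀ x y, x ≠ y → ¬ G.Adj x y → ∃ w, GoodWord G g w ∧ ¬ Alternates w x y := by
    intro x y hxy hadj
    rcases le_total (g x) (g y) with h | h
    · exact exists_word_aux hg3 hxy hadj h
    · obtain ⟨w, hw, hw'⟩ := exists_word_aux hg3 hxy.symm (fun h => hadj h.symm) h
      exact ⟨w, hw, fun h => hw' h.symm'⟩
  have h2 : ∀ L : List (V × V), (∀ p ∈ L, p.1 ≠ p.2 ∧ ¬ G.Adj p.1 p.2) →
      ∃ w, GoodWord G g w ∧ (∀ v, v ∈ w) ∧ ∀ p ∈ L, ¬ Alternates w p.1 p.2 := by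
    intro L
    induction L with
    | nil =>
      intro _
      obtain ⟨P, hm, hP⟩ := exists_sorted g
      exact ⟨P, goodWord_of_sorted (fun _ _ _ h => h) hP, hm, by simp⟩
    | cons p L ih =>
      intro hL
      obtain ⟨w, hw, hm, hw'⟩ := ih (fun q hq => hL q (List.mem_cons_of_mem _ hq))
      obtain ⟨hp1, hp2⟩ := hL p List.mem_cons_self
      obtain ⟨w1, hw1, hw1'⟩ := h1 _ _ hp1 hp2
      refine ⟨w1 ++ w, hw1.append hw, fun v => List.mem_append_right _ (hm v), ?_⟩
      intro q hq
      rcases List.mem_cons.1 hq with rfl | hq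
      · exact fun h => hw1' h.left
      · exact fun h => hw' q hq h.right
  obtain ⟨w, hw, hm, hw'⟩ := h2
    ((Finset.univ : Finset (V × V)).filter (fun p => p.1 ≠ p.2 ∧ ¬ G.Adj p.1 p.2)).toList
    (by intro p hp; simpa using hp)
  refine ⟨w, hm, fun x y hxy => ⟨fun h => ?_, fun h => ?_⟩⟩
  · by_contra hadj
    exact hw' (x, y) (by simp [hxy, hadj]) h
  · rcases lt_or_gt_of_ne (hg x y h) with h' | h'
    · exact ((hw x y h h').chain hxy).1
    · have : Alternates w y x := ((hw y x h.symm h').chain hxy.symm).1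
      exact this.symm'

/-- `f` is a proper colouring of the subgraph induced on `T`. -/
def ProperOn {V : Type*} (G : SimpleGraph V) (f : V → Fin 3) (T : Finset V) : Prop :=
  ∀ u ∈ T, ∀ v ∈ T, G.Adj u v → f u ≠ f v

lemma extend_card {V : Type*} [Fintype V] [DecidableEq V] {G : SimpleGraph V}
    [DecidableRel G.Adj] {f : V → Fin 3} {T : Finset V} {v : V} (hv : v ∉ T)
    (hf : ProperOn G f T) (hc : ((G.neighborFinset v ∩ T).image f).card ≤ 2) :
    ∃ f' : V → Fin 3, ProperOn G f' (insert v T) ∧ ∀ t ∈ T, f' t = f t := by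
  obtain ⟨c, hc⟩ : ∃ c : Fin 3, c ∉ (G.neighborFinset v ∩ T).image f := by
    by_contra! hcon
    have : (G.neighborFinset v ∩ T).image f = Finset.univ := by
      ext c; simpa using hcon c
    rw [this] at hc
    simp at hc
  have hc' : ∀ t ∈ T, G.Adj v t → f t ≠ c := by
    intro t ht hadj e
    exact hc (Finset.mem_image.2 ⟨t, by simp [ht, hadj], e⟩)
  have hag : ∀ t ∈ T, Function.update f v c t = f t := by
    intro t ht
    exact Function.update_of_ne (by rintro rfl; exact hv ht) _ _
  refine ⟨Function.update f v c, ?_, hag⟩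
  intro a ha b hb hab
  rcases Finset.mem_insert.1 ha with ea | ha'
  · subst ea
    rcases Finset.mem_insert.1 hb with eb | hb'
    · exact (hab.ne eb.symm).elim
    · rw [hag b hb', Function.update_self]
      exact (hc' b hb' hab).symm
  · rcases Finset.mem_insert.1 hb with eb | hb'
    · subst eb
      rw [hag a ha', Function.update_self]
      exact hc' a ha' hab.symm
    · rw [hag a ha', hag b hb']
      exact hf a ha' b hb' hab

lemma extend_nbr {V : Type*} [Fintype V] [DecidableEq V] {G : SimpleGraph V}
    [DecidableRel G.Adj] (h3 : ∀ v, G.degree v ≤ 3) {f : V → Fin 3} {T : Finset V} {v : V}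
    (hv : v ∉ T) (hf : ProperOn G f T)
    (hu : ∃ u, G.Adj v u ∧ (u ∉ T ∨ ∃ w, w ≠ u ∧ G.Adj v w ∧ f w = f u)) :
    ∃ f' : V → Fin 3, ProperOn G f' (insert v T) ∧ ∀ t ∈ T, f' t = f t := by
  obtain ⟨u, hvu, hu⟩ := hu
  refine extend_card hv hf ?_
  have hsub : (G.neighborFinset v ∩ T).image f ⊆ ((G.neighborFinset v).erase u).image f := by
    intro c hc
    obtain ⟨t, ht, rfl⟩ := Finset.mem_image.1 hc
    rw [Finset.mem_inter] at ht
    by_cases htu : t = u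
    · subst htu
      rcases hu with hu | ⟨w, hwu, hvw, e⟩
      · exact (hu ht.2).elim
      · exact Finset.mem_image.2 ⟨w, by simp [hwu, hvw], e⟩
    · exact Finset.mem_image.2 ⟨t, Finset.mem_erase.2 ⟨htu, ht.1⟩, rfl⟩
  have h1 := Finset.card_le_card hsub
  have h2 := Finset.card_image_le (s := (G.neighborFinset v).erase u) (f := f)
  have h4 : ((G.neighborFinset v).erase u).card + 1 = (G.neighborFinset v).card :=
    Finset.card_erase_add_one (by simpa using hvu)
  have h5 := h3 v
  rw [← G.card_neighborFinset_eq_degree] at h5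
  omega

/-- Every entry of the list except the last is adjacent to some later entry. -/
def LaterNbr {V : Type*} (G : SimpleGraph V) : List V → Prop
  | [] => True
  | a :: l => (l = [] ∨ ∃ b ∈ l, G.Adj a b) ∧ LaterNbr G l

lemma laterNbr_append {V : Type*} {G : SimpleGraph V} {b : V} {l₂ : List V} (hb : b ∈ l₂)
    (h₂ : LaterNbr G l₂) : ∀ l₁ : List V, (l₁ ++ [b]).IsChain G.Adj → LaterNbr G (l₁ ++ l₂)
  | [], _ => by simpa using h₂
  | [a], h => by
    simp at h
    exact ⟨Or.inr ⟨b, hb, h⟩, h₂⟩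
  | a :: c :: l, h => by
    simp only [List.cons_append, List.isChain_cons_cons] at h
    refine ⟨Or.inr ⟨c, by simp, h.1⟩, ?_⟩
    exact laterNbr_append hb h₂ (c :: l) h.2

/-- Greedy colouring along a list whose last vertex sees two equally coloured vertices. -/
lemma greedy {V : Type*} [Fintype V] [DecidableEq V] {G : SimpleGraph V}
    [DecidableRel G.Adj] (h3 : ∀ v, G.degree v ≤ 3) {u w z : V} (huw : w ≠ u)
    (hzu : G.Adj z u) (hzw : G.Adj z w) :
    ∀ (l : List V) (T : Finset V) (f : V → Fin 3), ProperOn G f T → u ∈ T → w ∈ T → f w = f u →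
      LaterNbr G (l ++ [z]) → (l ++ [z]).Nodup → (∀ a ∈ l ++ [z], a ∉ T) →
      ∃ f' : V → Fin 3, ProperOn G f' (T ∪ (l ++ [z]).toFinset) := by
  intro l
  induction l with
  | nil =>
    intro T f hf hu hw e _ _ hd
    obtain ⟨f', hf', -⟩ := extend_nbr h3 (hd z (by simp)) hf ⟨u, hzu, Or.inr ⟨w, huw, hzw, e⟩⟩
    refine ⟨f', ?_⟩
    convert hf' using 1
    ext a
    simp
  | cons a l ih =>
    intro T f hf hu hw e hL hnd hd
    have hL1 := hL.1
    have hL2 : LaterNbr G (l ++ [z]) := hL.2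
    have haT : a ∉ T := hd a (by simp)
    obtain ⟨b, hb, hab⟩ : ∃ b ∈ l ++ [z], G.Adj a b := by
      rcases hL1 with h | h
      · simp at h
      · exact h
    obtain ⟨f', hf', hag⟩ := extend_nbr h3 haT hf
      ⟨b, hab, Or.inl (hd b (List.mem_cons_of_mem _ hb))⟩
    rw [List.cons_append, List.nodup_cons] at hnd
    obtain ⟨f'', hf''⟩ := ih (insert a T) f' hf' (by simp [hu]) (by simp [hw])
      (by rw [hag u hu, hag w hw, e]) hL2 hnd.2 (by
        intro c hc hcT
        rcases Finset.mem_insert.1 hcT with rfl | hcT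
        · exact hnd.1 hc
        · exact hd c (List.mem_cons_of_mem _ hc) hcT)
    refine ⟨f'', ?_⟩
    convert hf'' using 1
    ext t
    simp only [List.cons_append, List.toFinset_cons, Finset.mem_union, Finset.mem_insert]
    tauto

/-- Split a list after the last entry satisfying `p`. -/
lemma split_last {V : Type*} (p : V → Prop) : ∀ l : List V, (∃ a ∈ l, p a) →
    ∃ l₁ a l₂, l = l₁ ++ a :: l₂ ∧ p a ∧ ∀ b ∈ l₂, ¬ p b := by
  classical
  intro l
  induction l with
  | nil => simp
  | cons c l ih =>
    intro h
    by_cases h' : ∃ a ∈ l, p a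
    · obtain ⟨l₁, a, l₂, rfl, ha, hb⟩ := ih h'
      exact ⟨c :: l₁, a, l₂, rfl, ha, hb⟩
    · refine ⟨[], c, l, rfl, ?_, fun b hb hpb => h' ⟨b, hb, hpb⟩⟩
      obtain ⟨a, ha, hpa⟩ := h
      rcases List.mem_cons.1 ha with rfl | ha
      · exact hpa
      · exact (h' ⟨a, ha, hpa⟩).elim

/-- Consecutive entries at which `p` becomes true. -/
lemma split_first {V : Type*} (p : V → Prop) : ∀ (l : List V) (h : V), ¬ p h →
    (∃ a ∈ l, p a) → ∃ l₁ a b l₂, h :: l = l₁ ++ a :: b :: l₂ ∧ ¬ p a ∧ p b := by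
  classical
  intro l
  induction l with
  | nil => simp
  | cons c l ih =>
    intro h hh hex
    by_cases hc : p c
    · exact ⟨[], h, c, l, rfl, hh, hc⟩
    · obtain ⟨l₁, a, b, l₂, e, ha, hb⟩ := ih c hc (by
        obtain ⟨a, ha, hpa⟩ := hex
        rcases List.mem_cons.1 ha with rfl | ha
        · exact (hc hpa).elim
        · exact ⟨a, ha, hpa⟩)
      exact ⟨h :: l₁, a, b, l₂, by rw [e]; rfl, ha, hb⟩

lemma brooks_three {V : Type*} [Fintype V] [DecidableEq V] (G : SimpleGraph V)
    [DecidableRel G.Adj] (h3 : ∀ v, G.degree v ≤ 3) (n : ℕ) :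
    ∀ S : Finset V, S.card = n → (∀ K ⊆ S, ¬ G.IsNClique 4 K) →
      ∃ f : V → Fin 3, ProperOn G f S := by
  induction n using Nat.strong_induction_on with
  | _ n ih =>
  intro S hSn hK
  have ih' : ∀ T ⊂ S, ∃ f : V → Fin 3, ProperOn G f T := fun T hT =>
    ih T.card (hSn ▸ Finset.card_lt_card hT) T rfl (fun K hKT => hK K (hKT.trans hT.1))
  -- reduce to the case where every vertex of `S` has three neighbours in `S`
  by_cases hlow : ∃ v ∈ S, (G.neighborFinset v ∩ S).card ≤ 2
  · obtain ⟨v, hv, hc⟩ := hlow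
    obtain ⟨f, hf⟩ := ih' (S.erase v) (Finset.erase_ssubset hv)
    obtain ⟨f', hf', -⟩ := extend_card (Finset.notMem_erase v S) hf
      (Finset.card_image_le.trans ((Finset.card_le_card
        (Finset.inter_subset_inter_left (Finset.erase_subset v S))).trans hc))
    rw [Finset.insert_erase hv] at hf'
    exact ⟨f', hf'⟩
  push Not at hlow
  have hdeg : ∀ v ∈ S, (G.neighborFinset v).card = 3 ∧ ∀ u, G.Adj v u → u ∈ S := by
    intro v hv
    have h1 := hlow v hv
    have h2 := h3 v
    rw [← G.card_neighborFinset_eq_degree] at h2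
    have h4 := Finset.card_le_card
      (Finset.inter_subset_left : G.neighborFinset v ∩ S ⊆ G.neighborFinset v)
    have h5 : G.neighborFinset v ∩ S = G.neighborFinset v :=
      Finset.eq_of_subset_of_card_le Finset.inter_subset_left (by omega)
    refine ⟨by omega, fun u hu => ?_⟩
    have : u ∈ G.neighborFinset v ∩ S := by rw [h5]; simpa using hu
    exact (Finset.mem_inter.1 this).2
  rcases S.eq_empty_or_nonempty with rfl | ⟨x2, hx2⟩
  · exact ⟨fun _ => 0, by simp [ProperOn]⟩
  obtain ⟨x1, x3, h21, h23, h13, hn13⟩ : ∃ x1 x3, G.Adj x2 x1 ∧ G.Adj x2 x3 ∧ x1 ≠ x3 ∧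
      ¬ G.Adj x1 x3 := by
    by_contra! hcon
    refine hK (insert x2 (G.neighborFinset x2)) ?_ ⟨?_, ?_⟩
    · intro u hu
      rcases Finset.mem_insert.1 hu with rfl | hu
      · exact hx2
      · exact (hdeg x2 hx2).2 u (by simpa using hu)
    · intro a ha b hb hab
      simp at ha hb
      rcases ha with rfl | ha
      · rcases hb with rfl | hb
        · exact (hab rfl).elim
        · exact hb
      · rcases hb with rfl | hb
        · exact ha.symm
        · exact hcon a b ha hb hab
    · rw [Finset.card_insert_of_notMem (by simp), (hdeg x2 hx2).1]
  have hx1 := (hdeg x2 hx2).2 x1 h21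
  have hx3 := (hdeg x2 hx2).2 x3 h23
  -- a longest path ending in `x3, x2, x1`
  let Good : List V → Prop := fun m => (m ++ [x3, x2, x1]).IsChain G.Adj ∧
    (m ++ [x3, x2, x1]).Nodup ∧ ∀ a ∈ m ++ [x3, x2, x1], a ∈ S
  have hbase : Good [] := by
    refine ⟨by simp [h23.symm, h21], by simp [h23.ne.symm, h21.ne, h13.symm], ?_⟩
    simp [hx1, hx2, hx3]
  obtain ⟨m, hm, hmax⟩ : ∃ m, Good m ∧ ∀ a, ¬ Good (a :: m) := by
    by_contra! hcon
    have : ∀ k, ∃ m, Good m ∧ m.length = k := by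
      intro k
      induction k with
      | zero => exact ⟨[], hbase, rfl⟩
      | succ k ihk =>
        obtain ⟨m, hm, hk⟩ := ihk
        obtain ⟨a, ha⟩ := hcon m hm
        exact ⟨a :: m, ha, by simp [hk]⟩
    obtain ⟨m, hm, hk⟩ := this (Fintype.card V + 1)
    have := (List.Nodup.of_append_left hm.2.1).length_le_card
    omega
  obtain ⟨hch, hnd, hS⟩ := hm
  by_cases hcov : ∀ a ∈ S, a ∈ m ++ [x3, x2, x1]
  · -- the path covers `S`
    obtain ⟨x', hx', hx'1, hx'3⟩ : ∃ x', G.Adj x2 x' ∧ x' ≠ x1 ∧ x' ≠ x3 := by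
      by_contra! hcon
      have : G.neighborFinset x2 ⊆ {x1, x3} := by
        intro a ha
        have := hcon a (by simpa using ha)
        simp; tauto
      have := Finset.card_le_card this
      rw [(hdeg x2 hx2).1] at this
      have := Finset.card_le_two (a := x1) (b := x3)
      omega
    have hx'm : x' ∈ m := by
      have := hcov x' ((hdeg x2 hx2).2 x' hx')
      simp [hx'1, hx'3, hx'.ne.symm] at this
      exact this
    obtain ⟨m1, m2, rfl⟩ := List.append_of_mem hx'm
    have hchm : (m1 ++ x' :: m2).IsChain G.Adj := hch.left_of_append
    have hL2 : LaterNbr G (m1 ++ [x', x2]) := by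
      refine laterNbr_append (b := x') (by simp) ?_ m1 ?_
      · exact ⟨Or.inr ⟨x2, by simp, hx'.symm⟩, Or.inl rfl, trivial⟩
      · exact (List.isChain_split.1 hchm).1
    have hL : LaterNbr G ((m2.reverse ++ (m1 ++ [x'])) ++ [x2]) := by
      have : LaterNbr G (m2.reverse ++ (m1 ++ [x', x2])) := by
        refine laterNbr_append (b := x') (by simp) hL2 _ ?_
        have h := (List.isChain_split.1 hchm).2
        rw [← List.reverse_cons, List.isChain_reverse]
        exact h.imp (fun a b hab => hab.symm)
      simpa using this
    obtain ⟨f', hf'⟩ := greedy h3 h13 h23 h21 (m2.reverse ++ (m1 ++ [x'])) {x1, x3}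
      (fun _ => 0) (by
        intro a ha b hb hab
        simp at ha hb
        rcases ha with rfl | rfl <;> rcases hb with rfl | rfl
        · exact (hab.ne rfl).elim
        · exact (hn13 hab).elim
        · exact (hn13 hab.symm).elim
        · exact (hab.ne rfl).elim) (by simp) (by simp) rfl hL (by
          have hp : (m2.reverse ++ (m1 ++ [x']) ++ [x2]).Perm (m1 ++ x' :: m2 ++ [x2]) := by
            refine List.Perm.append_right _ ?_
            refine ((List.reverse_perm m2).append_right _).trans ?_
            refine List.perm_append_comm.trans ?_
            simp
          rw [hp.nodup_iff]
          refine hnd.sublist ?_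
          refine List.Sublist.append (List.Sublist.refl _) ?_
          simp) (by
          intro a ha haT
          have hnd' := List.disjoint_of_nodup_append hnd
          simp only [List.mem_append, List.mem_reverse, List.mem_singleton] at ha
          have : a ∈ [x3, x2, x1] := by
            simp at haT; rcases haT with rfl | rfl <;> simp
          rcases ha with (ha | ha | rfl) | rfl
          · exact hnd' (by simp [ha]) this
          · exact hnd' (by simp [ha]) this
          · exact hnd' (by simp) this
          · simp [h21.ne, h23.ne] at haT)
    refine ⟨f', fun a ha b hb hab => ?_⟩
    have hsub : ∀ a ∈ S, a ∈ ({x1, x3} : Finset V) ∪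
        (m2.reverse ++ (m1 ++ [x']) ++ [x2]).toFinset := by
      intro a ha
      have := hcov a ha
      simp at this ⊢
      tauto
    exact hf' a (hsub a ha) b (hsub b hb) hab
  -- the path does not cover `S`
  obtain ⟨h, q, hq⟩ : ∃ h q, m ++ [x3, x2, x1] = h :: q := by
    cases m with
    | nil => exact ⟨_, _, rfl⟩
    | cons a m => exact ⟨_, _, rfl⟩
  have hmax' : ∀ a, G.Adj h a → a ∈ h :: q := by
    intro a ha
    by_contra hna
    have hhS : h ∈ S := hS h (by simp [hq])
    refine hmax a ⟨?_, ?_, ?_⟩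
    · rw [List.cons_append, hq, List.isChain_cons_cons]
      exact ⟨ha.symm, hq ▸ hch⟩
    · rw [List.cons_append, hq, List.nodup_cons]
      exact ⟨hna, hq ▸ hnd⟩
    · rw [List.cons_append]
      intro b hb
      rcases List.mem_cons.1 hb with rfl | hb
      · exact (hdeg h hhS).2 _ ha
      · exact hS b hb
  rw [hq] at hch hnd hS hcov
  have hhS : h ∈ S := hS h (by simp)
  obtain ⟨c, xj, rest, hqe, hhj, hrest⟩ := split_last (G.Adj h) q (by
    obtain ⟨a, ha⟩ : (G.neighborFinset h).Nonempty := by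
      rw [← Finset.card_pos, (hdeg h hhS).1]; norm_num
    rw [SimpleGraph.mem_neighborFinset] at ha
    refine ⟨a, ?_, ha⟩
    rcases List.mem_cons.1 (hmax' a ha) with rfl | h'
    · exact (ha.ne rfl).elim
    · exact h')
  have hqe' : h :: q = (h :: (c ++ [xj])) ++ rest := by rw [hqe]; simp
  have hcch : (h :: (c ++ [xj])).IsChain G.Adj := by rw [hqe'] at hch; exact hch.left_of_append
  have hcnd : (h :: (c ++ [xj])).Nodup := by
    rw [hqe'] at hnd; exact List.Nodup.of_append_left hnd
  have hcS : ∀ a ∈ h :: (c ++ [xj]), a ∈ S := fun a ha => hS a (by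
    rw [hqe']; exact List.mem_append_left _ ha)
  have hhc : ∀ a, G.Adj h a → a ∈ h :: (c ++ [xj]) := by
    intro a ha
    have := hmax' a ha
    rw [hqe'] at this
    rcases List.mem_append.1 this with h' | h'
    · exact h'
    · exact (hrest a h' ha).elim
  set C : Finset V := (h :: (c ++ [xj])).toFinset with hC
  have hCS : C ⊆ S := fun a ha => hcS a (by rwa [hC, List.mem_toFinset] at ha)
  have hCh : h ∈ C := by simp [hC]
  obtain ⟨f, hf⟩ := ih' (S \ C) (Finset.sdiff_ssubset hCS ⟨h, hCh⟩)
  have hCmem : ∀ a, a ∈ C ↔ a ∈ h :: (c ++ [xj]) := fun a => by rw [hC, List.mem_toFinset]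
  by_cases hout : ∃ a ∈ c ++ [xj], ∃ b, G.Adj a b ∧ b ∉ C
  · obtain ⟨l₁, p, z, l₂, e, hp, y, hzy, hyC⟩ := split_first (fun a => ∃ b, G.Adj a b ∧ b ∉ C)
      (c ++ [xj]) h (by
        rintro ⟨b, hb, hbC⟩
        exact hbC ((hCmem b).2 (hhc b hb))) hout
    push Not at hp
    rw [e] at hcch hcnd
    have hCe : ∀ a, a ∈ C ↔ a ∈ l₁ ++ p :: z :: l₂ := fun a => by rw [hCmem, e]
    have hpC : p ∈ C := (hCe p).2 (by simp)
    have hzC : z ∈ C := (hCe z).2 (by simp)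
    have hyS : y ∈ S := (hdeg z (hCS hzC)).2 y hzy
    have hyT : y ∈ S \ C := Finset.mem_sdiff.2 ⟨hyS, hyC⟩
    have hpz : G.Adj p z := by
      have := hcch.right_of_append
      rw [List.isChain_cons_cons] at this
      exact this.1
    have hpy : p ≠ y := by rintro rfl; exact hyC hpC
    have hupd : ∀ t, t ∉ C → Function.update f p (f y) t = f t := by
      intro t ht
      exact Function.update_of_ne (by rintro rfl; exact ht hpC) _ _
    have hlast : (l₁ ++ p :: z :: l₂).getLast? = some xj := by
      rw [← e, ← List.cons_append, List.getLast?_concat]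
    have hhead : (l₁ ++ p :: z :: l₂).head? = some h := by rw [← e]; simp
    have hL : (l₁.reverse ++ (z :: l₂).reverse).IsChain G.Adj := by
      rw [← List.reverse_append, List.isChain_reverse]
      have hsymm : ∀ l : List V, l.IsChain G.Adj → l.IsChain (fun a b => G.Adj b a) :=
        fun l hl => hl.imp (fun a b hab => hab.symm)
      refine List.IsChain.append ?_ ?_ ?_
      · exact hsymm _ hcch.right_of_append.tail
      · exact hsymm _ hcch.left_of_append
      · intro a ha b hb
        have ha' : a = xj := by
          have h1 : (l₁ ++ p :: z :: l₂).getLast? = (z :: l₂).getLast? := by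
            rw [show l₁ ++ p :: z :: l₂ = (l₁ ++ [p]) ++ (z :: l₂) by simp]
            rw [List.getLast?_append_of_ne_nil _ (by simp)]
          rw [h1] at hlast
          rw [hlast] at ha
          simpa using ha.symm
        have hb' : b = h := by
          cases l₁ with
          | nil => simp at hb
          | cons d l₁ =>
            simp at hb hhead
            rw [← hb, hhead]
        rw [ha', hb']
        exact hhj
    have hL' : LaterNbr G ((l₁.reverse ++ l₂.reverse) ++ [z]) := by
      refine laterNbr_append (b := z) (by simp) (show LaterNbr G [z] from ⟨Or.inl rfl, trivial⟩) _ ?_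
      simpa using hL
    have hperm : (p :: (l₁.reverse ++ l₂.reverse ++ [z])).Perm (l₁ ++ p :: z :: l₂) := by
      rw [List.append_assoc, ← List.reverse_cons]
      refine List.Perm.trans ?_ List.perm_middle.symm
      refine List.Perm.cons _ ?_
      exact (List.reverse_perm _).append (List.reverse_perm _)
    have hnd2 := hperm.nodup_iff.2 hcnd
    rw [List.nodup_cons] at hnd2
    obtain ⟨f', hf'⟩ := greedy h3 hpy hzy hpz.symm (l₁.reverse ++ l₂.reverse)
      (insert p (S \ C)) (Function.update f p (f y)) (by
        intro a ha b hb hab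
        rw [Finset.mem_insert, Finset.mem_sdiff] at ha hb
        rcases ha with rfl | ha
        · rcases hb with rfl | hb
          · exact (hab.ne rfl).elim
          · exact (hb.2 (hp b hab)).elim
        · rcases hb with rfl | hb
          · exact (ha.2 (hp a hab.symm)).elim
          · rw [hupd a ha.2, hupd b hb.2]
            exact hf a (by simp [ha]) b (by simp [hb]) hab)
      (by rw [Finset.mem_insert]; exact Or.inr hyT) (by simp)
      (by rw [hupd y hyC, Function.update_self]) hL' hnd2.2 (by
        intro a ha haT
        rcases Finset.mem_insert.1 haT with rfl | haT
        · exact hnd2.1 ha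
        · exact (Finset.mem_sdiff.1 haT).2 ((hCe a).2
            (hperm.mem_iff.1 (List.mem_cons_of_mem _ ha))))
    have hsub : ∀ a ∈ S, a ∈ insert p (S \ C) ∪ (l₁.reverse ++ l₂.reverse ++ [z]).toFinset := by
      intro a ha
      by_cases haC : a ∈ C
      · have := hperm.mem_iff.2 ((hCe a).1 haC)
        rw [List.mem_cons] at this
        rw [Finset.mem_union, Finset.mem_insert, List.mem_toFinset]
        tauto
      · rw [Finset.mem_union, Finset.mem_insert, Finset.mem_sdiff]
        tauto
    exact ⟨f', fun a ha b hb hab => hf' a (hsub a ha) b (hsub b hb) hab⟩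
  · -- the cycle is a union of components
    have hclosed : ∀ a ∈ C, ∀ b, G.Adj a b → b ∈ C := by
      intro a ha b hab
      rcases List.mem_cons.1 ((hCmem a).1 ha) with rfl | ha
      · exact (hCmem b).2 (hhc b hab)
      · by_contra hb
        exact hout ⟨a, ha, b, hab, hb⟩
    have hCne : C ⊂ S := by
      refine Finset.ssubset_iff_subset_ne.2 ⟨hCS, ?_⟩
      intro e
      refine hcov (fun a ha => ?_)
      rw [← e, hCmem] at ha
      rw [hqe']
      exact List.mem_append_left _ ha
    obtain ⟨f2, hf2⟩ := ih' C hCne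
    refine ⟨fun v => if v ∈ C then f2 v else f v, ?_⟩
    intro a ha b hb hab
    by_cases haC : a ∈ C
    · have hbC := hclosed a haC b hab
      simp only [haC, hbC, if_true]
      exact hf2 a haC b hbC hab
    · have hbC : b ∉ C := fun hbC => haC (hclosed b hbC a hab.symm)
      simp only [haC, hbC, if_false]
      exact hf a (Finset.mem_sdiff.2 ⟨ha, haC⟩) b (Finset.mem_sdiff.2 ⟨hb, hbC⟩) hab

lemma exists_coloring {V : Type*} [Fintype V] [DecidableEq V] (G : SimpleGraph V)
    [DecidableRel G.Adj] (h3 : ∀ v, G.degree v ≤ 3) :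
    ∃ g : V → ℕ, (∀ u v, G.Adj u v → g u ≠ g v) ∧
      ∀ x y, G.Reachable x y → x ≠ y → ¬ G.Adj x y → ∀ z, G.Reachable x z → g z < 3 := by
  classical
  -- a minimal set of vertices meeting every 4-clique
  obtain ⟨D, hD, hmin⟩ : ∃ D : Finset V, (∀ K, G.IsNClique 4 K → ∃ d ∈ D, d ∈ K) ∧
      ∀ D' ⊂ D, ¬ ∀ K, G.IsNClique 4 K → ∃ d ∈ D', d ∈ K := by
    have hex : (Finset.univ.filter (fun D : Finset V =>
        ∀ K, G.IsNClique 4 K → ∃ d ∈ D, d ∈ K)).Nonempty := by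
      refine ⟨Finset.univ, ?_⟩
      simp only [Finset.mem_filter, Finset.mem_univ, true_and]
      intro K hK
      have : K.Nonempty := by rw [← Finset.card_pos, hK.card_eq]; norm_num
      exact this
    obtain ⟨D, hD⟩ := Finset.exists_minimal hex
    refine ⟨D, (Finset.mem_filter.1 hD.1).2, fun D' hD' hcon => ?_⟩
    exact hD'.2 (hD.2 (Finset.mem_filter.2 ⟨Finset.mem_univ _, hcon⟩) hD'.1)
  have hclosed : ∀ K, G.IsNClique 4 K → ∀ a ∈ K, ∀ b, G.Adj a b → b ∈ K := by
    intro K hK a ha b hab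
    have hsub : K.erase a ⊆ G.neighborFinset a := by
      intro c hc
      rw [Finset.mem_erase] at hc
      rw [SimpleGraph.mem_neighborFinset]
      exact hK.isClique ha hc.2 (Ne.symm hc.1)
    have h1 : (K.erase a).card = 3 := by rw [Finset.card_erase_of_mem ha, hK.card_eq]
    have h2 := h3 a
    rw [← G.card_neighborFinset_eq_degree] at h2
    have h4 := Finset.eq_of_subset_of_card_le hsub (by omega)
    have : b ∈ K.erase a := by rw [h4]; simpa using hab
    exact Finset.mem_of_mem_erase this
  have hreach : ∀ K, G.IsNClique 4 K → ∀ a ∈ K, ∀ b, G.Reachable a b → b ∈ K := by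
    rintro K hK a ha b ⟨w⟩
    induction w with
    | nil => exact ha
    | cons hab _ ihw => exact ihw (hclosed K hK _ ha _ hab)
  have hDK : ∀ d ∈ D, ∃ K, G.IsNClique 4 K ∧ d ∈ K ∧ ∀ e ∈ D, e ∈ K → e = d := by
    intro d hd
    have := hmin (D.erase d) (Finset.erase_ssubset hd)
    push Not at this
    obtain ⟨K, hK, hKD⟩ := this
    have huniq : ∀ e ∈ D, e ∈ K → e = d := by
      intro e he heK
      by_contra hne
      exact hKD e (Finset.mem_erase.2 ⟨hne, he⟩) heK
    obtain ⟨e, he, heK⟩ := hD K hK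
    exact ⟨K, hK, huniq e he heK ▸ heK, huniq⟩
  obtain ⟨f, hf⟩ := brooks_three G h3 _ (Finset.univ \ D) rfl (by
    intro K hKD hK
    obtain ⟨d, hd, hdK⟩ := hD K hK
    exact (Finset.mem_sdiff.1 (hKD hdK)).2 hd)
  refine ⟨fun v => if v ∈ D then 3 else (f v : ℕ), ?_, ?_⟩
  · intro u v huv
    by_cases hu : u ∈ D
    · by_cases hv : v ∈ D
      · obtain ⟨K, hK, huK, huq⟩ := hDK u hu
        exact (huv.ne (huq v hv (hclosed K hK u huK v huv)).symm).elim
      · have := (f v).isLt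
        simp only [hu, hv, if_true, if_false]
        omega
    · by_cases hv : v ∈ D
      · have := (f u).isLt
        simp only [hu, hv, if_true, if_false]
        omega
      · simp only [hu, hv, if_false]
        exact fun e => hf u (by simp [hu]) v (by simp [hv]) huv (Fin.ext e)
  · intro x y hxy hne hadj z hxz
    by_cases hz : z ∈ D
    · obtain ⟨K, hK, hzK, -⟩ := hDK z hz
      have hxK := hreach K hK z hzK x hxz.symm
      have hyK := hreach K hK x hxK y hxy
      exact (hadj (hK.isClique hxK hyK hne)).elim
    · simp only [hz, if_false]
      exact (f z).isLt

theorem maxDegree_three_wordRepresentable {V : Type*} [Fintype V] [DecidableEq V]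
    (G : SimpleGraph V) [DecidableRel G.Adj] (h : ∀ v : V, G.degree v ≤ 3) :
    WordRepresentable G := by
  obtain ⟨g, hg, hg3⟩ := exists_coloring G h
  exact wordRepresentable_of_coloring hg hg3
end
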